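/- Suppose ℓ ≥ max{|s−p|, p, 1} (so 𝓛 = 𝓛₀ + 𝓛₁ : H^s → H^{s−k} is bounded), that 𝓛 : H^s → H^{s−k} is invertible, and let f ∈ H^{s−k}. Then for every integer N satisfying ‖𝓝‖_{s−k→s} D_{s−p,s−k} N^{p−k} ‖𝓛₁‖_{s→s−p} < (1/2)·‖𝓛^{−1}𝓝^{−1}‖_{s→s}^{−1} (where D_{s−p,s−k} is a constant with ‖id − 𝒫_N‖_{s−p→s−k} ≤ D_{s−p,s−k}N^{p−k}): the operator 𝓛₀ + 𝒫_N𝓛₁ : ran 𝒫_N → ran 𝒫_N is invertible, and there exist constants c, C > 0, independent of N and f, with C ≤ 2‖𝓛^{−1}𝓝^{−1}‖_{s→s} ‖𝓝‖_{s−k→s} ‖𝓛₀‖_{s→s−k}, such that the unique u_N ∈ ran 𝒫_N with (𝓛₀ + 𝒫_N𝓛₁)u_N = 𝒫_N f satisfies c‖u − 𝒫_N u‖_s ≤ ‖u − u_N‖_s ≤ C‖u − 𝒫_N u‖_s, where u = 𝓛^{−1}f. -/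

import Mathlib

noncomputable section

open scoped BigOperators

/-- The Sobolev weight `max(1,|j|)`. -/
def wt (j : ℤ) : ℝ := max 1 |(j : ℝ)|

/-- Membership of a two-sided sequence in the Sobolev space `H^s`. -/
def hsumm (s : ℝ) (u : ℤ → ℂ) : Prop :=
  Summable fun j : ℤ => ‖u j‖ ^ 2 * wt j ^ (2 * s)

/-- The `H^s` norm of a two-sided sequence. -/
def hnorm (s : ℝ) (u : ℤ → ℂ) : ℝ :=
  Real.sqrt (∑' j : ℤ, ‖u j‖ ^ 2 * wt j ^ (2 * s))

/-- `N₋ = ⌊N/2⌋`. -/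
def Nmin (N : ℕ) : ℤ := (N : ℤ) / 2

/-- `N₊ = ⌊(N-1)/2⌋`. -/
def Npl (N : ℕ) : ℤ := ((N : ℤ) - 1) / 2

/-- The Fourier truncation projection `𝒫_N`. -/
def projP (N : ℕ) (u : ℤ → ℂ) : ℤ → ℂ :=
  fun j => if -Nmin N ≤ j ∧ j ≤ Npl N then u j else 0

/-- The trigonometric interpolation projection `𝓘_N` (via the aliasing formula). -/
def interpI (N : ℕ) (u : ℤ → ℂ) : ℤ → ℂ :=
  fun j => if -Nmin N ≤ j ∧ j ≤ Npl N then ∑' p : ℤ, u (p * (N : ℤ) + j) else 0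

/-- Membership in `ran 𝒫_N`. -/
def inPN (N : ℕ) (u : ℤ → ℂ) : Prop := projP N u = u

/-- The symbol `m(j) = Σ_{r=q}^k c_r (i j)^r` of the constant-coefficient part `𝓛₀`. -/
def symb (q k : ℕ) (c : ℕ → ℂ) (j : ℤ) : ℂ :=
  ∑ r ∈ Finset.Icc q k, c r * (Complex.I * (j : ℂ)) ^ r

/-- The constant-coefficient operator `𝓛₀`, a Fourier multiplier with symbol `m(j)`. -/
def L0op (q k : ℕ) (c : ℕ → ℂ) (u : ℤ → ℂ) : ℤ → ℂ :=
  fun j => symb q k c j * u j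

/-- The variable-coefficient lower-order part `𝓛₁ u = Σ_{r=0}^p a_r · d^r u/dθ^r`,
acting on Fourier coefficients. -/
def L1op (p : ℕ) (a : ℕ → ℤ → ℂ) (u : ℤ → ℂ) : ℤ → ℂ :=
  fun n => ∑ r ∈ Finset.range (p + 1), ∑' j : ℤ, a r (n - j) * (Complex.I * (j : ℂ)) ^ r * u j

/-- The regulator `𝓝 = (𝓛₀ - ζ id)⁻¹`, a Fourier multiplier with symbol `(m(j) - ζ)⁻¹`. -/
def Nop (q k : ℕ) (c : ℕ → ℂ) (ζ : ℂ) (u : ℤ → ℂ) : ℤ → ℂ :=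
  fun j => (symb q k c j - ζ)⁻¹ * u j

/-- The condition `inf_j |m(j) - ζ| max(1,|j|)^{-k} > 0` on the regularization point `ζ`. -/
def zetaGood (q k : ℕ) (c : ℕ → ℂ) (ζ : ℂ) : Prop :=
  ∃ ε : ℝ, 0 < ε ∧ ∀ j : ℤ, ε ≤ ‖symb q k c j - ζ‖ * wt j ^ (-(k : ℝ))

/-- The operator norm of a map `T : H^s → H^t`, as the least admissible bound. -/
def opNorm (s t : ℝ) (T : (ℤ → ℂ) → (ℤ → ℂ)) : ℝ :=
  sInf {C : ℝ | 0 ≤ C ∧ ∀ u : ℤ → ℂ, hsumm s u → hnorm t (T u) ≤ C * hnorm s u}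

open scoped ENNReal

lemma one_le_wt (j : ℤ) : 1 ≤ wt j := le_max_left _ _

lemma wt_pos (j : ℤ) : 0 < wt j := one_pos.trans_le (one_le_wt j)

lemma wt_rpow_nonneg (j : ℤ) (s : ℝ) : 0 ≤ wt j ^ s := (Real.rpow_pos_of_pos (wt_pos j) s).le

lemma wt_neg (j : ℤ) : wt (-j) = wt j := by simp [wt]

lemma wt_sub_comm (n j : ℤ) : wt (n - j) = wt (j - n) := by rw [← wt_neg, neg_sub]

lemma wt_le_two_mul_max (n j : ℤ) : wt n ≤ 2 * max (wt (n - j)) (wt j) := by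
  have h1 : |(n : ℝ)| ≤ |((n - j : ℤ) : ℝ)| + |(j : ℝ)| := by
    have := abs_add_le ((n : ℝ) - j) j
    push_cast
    simpa using this
  have h2 : |((n - j : ℤ) : ℝ)| ≤ wt (n - j) := le_max_right _ _
  have h3 : |(j : ℝ)| ≤ wt j := le_max_right _ _
  have h4 := le_max_left (wt (n - j)) (wt j)
  have h5 := le_max_right (wt (n - j)) (wt j)
  have h6 := one_le_wt j
  exact max_le (by linarith) (by linarith)

lemma wt_rpow_sq (j : ℤ) (s : ℝ) : (wt j ^ s) ^ 2 = wt j ^ (2 * s) := by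
  rw [← Real.rpow_natCast, ← Real.rpow_mul (wt_pos j).le, mul_comm]; norm_num

lemma summable_wt_rpow {l : ℝ} (hl : 1 ≤ l) : Summable fun j : ℤ => wt j ^ (2 * (-l)) := by
  have h := Real.summable_abs_int_rpow (b := 2) (by norm_num)
  have h0 : Summable fun j : ℤ => |(j : ℝ)| ^ (-2 : ℝ) + if j = 0 then (1 : ℝ) else 0 :=
    h.add (summable_of_ne_finset_zero (s := {0}) (by intro b hb; simpa using hb))
  refine Summable.of_nonneg_of_le (fun j => wt_rpow_nonneg j _) (fun j => ?_) h0
  have h1 : wt j ^ (2 * (-l)) ≤ wt j ^ (-2 : ℝ) :=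
    Real.rpow_le_rpow_of_exponent_le (one_le_wt j) (by linarith)
  refine h1.trans ?_
  by_cases hj : j = 0
  · subst hj
    simp [wt]
  · have : (1 : ℝ) ≤ |(j : ℝ)| := by exact_mod_cast Int.one_le_abs hj
    simp [wt, hj, max_eq_right this]

/-- Peetre-type inequality for nonnegative exponents. -/
lemma wt_rpow_le_of_nonneg {t l : ℝ} (ht : 0 ≤ t) (htl : t ≤ l) (n j : ℤ) :
    wt n ^ t ≤ 2 ^ t * wt j ^ t * (1 + wt (n - j) ^ l * wt j ^ (-l)) := by
  have hn := wt_pos n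
  have hj := wt_pos j
  have hm := wt_pos (n - j)
  have h1 : wt n ^ t ≤ 2 ^ t * (max (wt (n - j)) (wt j)) ^ t := by
    rw [← Real.mul_rpow (by norm_num) (by positivity)]
    exact Real.rpow_le_rpow hn.le (wt_le_two_mul_max n j) ht
  refine h1.trans ?_
  rw [mul_assoc]
  refine mul_le_mul_of_nonneg_left ?_ (by positivity)
  have h3 := Real.rpow_pos_of_pos hj t
  have h4 : 0 < wt (n - j) ^ l * wt j ^ (-l) := by positivity
  rcases le_total (wt (n - j)) (wt j) with h | h
  · rw [max_eq_right h]
    nlinarith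
  · rw [max_eq_left h]
    have h5 : (wt (n - j) / wt j) ^ t ≤ (wt (n - j) / wt j) ^ l :=
      Real.rpow_le_rpow_of_exponent_le ((one_le_div hj).2 h) htl
    rw [Real.div_rpow hm.le hj.le, Real.div_rpow hm.le hj.le, div_eq_mul_inv (_ ^ l),
      ← Real.rpow_neg hj.le, div_le_iff₀ h3] at h5
    nlinarith

lemma wt_rpow_le {t l : ℝ} (htl : |t| ≤ l) (n j : ℤ) :
    wt n ^ t ≤ 2 ^ |t| * wt j ^ t * (1 + wt (n - j) ^ l * (wt j ^ (-l) + wt n ^ (-l))) := by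
  have hn := wt_pos n
  have hj := wt_pos j
  have hm := wt_pos (n - j)
  rcases le_total 0 t with ht | ht
  · rw [abs_of_nonneg ht] at *
    refine (wt_rpow_le_of_nonneg ht htl n j).trans ?_
    gcongr
    have := Real.rpow_pos_of_pos hn (-l)
    linarith
  · rw [abs_of_nonpos ht] at *
    have h := wt_rpow_le_of_nonneg (neg_nonneg.2 ht) htl j n
    rw [wt_sub_comm j n, Real.rpow_neg hj.le t, Real.rpow_neg hn.le t] at h
    have h1 := Real.rpow_pos_of_pos hn t
    have h2 := Real.rpow_pos_of_pos hj t
    have h3 : wt n ^ t ≤ 2 ^ (-t) * wt j ^ t * (1 + wt (n - j) ^ l * wt n ^ (-l)) := by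
      have := mul_le_mul_of_nonneg_left h (mul_pos h1 h2).le
      field_simp at this
      convert this using 1
      ring
    refine h3.trans ?_
    gcongr
    have := Real.rpow_pos_of_pos hj (-l)
    linarith

/-- The squared Sobolev norm as an extended nonnegative real. -/
def energy (s : ℝ) (u : ℤ → ℂ) : ℝ≥0∞ := ∑' j, ENNReal.ofReal (‖u j‖ * wt j ^ s) ^ 2

lemma ofReal_norm_mul_wt_sq (s : ℝ) (u : ℤ → ℂ) (j : ℤ) :
    ENNReal.ofReal (‖u j‖ * wt j ^ s) ^ 2 = ENNReal.ofReal (‖u j‖ ^ 2 * wt j ^ (2 * s)) := by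
  have := wt_rpow_nonneg j s
  rw [← ENNReal.ofReal_pow (by positivity), mul_pow, wt_rpow_sq]

lemma norm_sq_mul_wt_nonneg (s : ℝ) (u : ℤ → ℂ) (j : ℤ) : 0 ≤ ‖u j‖ ^ 2 * wt j ^ (2 * s) :=
  mul_nonneg (by positivity) (wt_rpow_nonneg j _)

lemma energy_eq {s : ℝ} {u : ℤ → ℂ} (hu : hsumm s u) :
    energy s u = ENNReal.ofReal (hnorm s u ^ 2) := by
  rw [hnorm, Real.sq_sqrt (tsum_nonneg (norm_sq_mul_wt_nonneg s u)),
    ENNReal.ofReal_tsum_of_nonneg (norm_sq_mul_wt_nonneg s u) hu, energy]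
  simp_rw [ofReal_norm_mul_wt_sq]

lemma hsumm_of_energy_ne_top {s : ℝ} {u : ℤ → ℂ} (hu : energy s u ≠ ⊤) : hsumm s u := by
  simp_rw [energy, ofReal_norm_mul_wt_sq] at hu
  have := ENNReal.summable_toReal hu
  simpa only [hsumm, ENNReal.toReal_ofReal (norm_sq_mul_wt_nonneg s u _)] using this

lemma hnorm_nonneg (s : ℝ) (u : ℤ → ℂ) : 0 ≤ hnorm s u := Real.sqrt_nonneg _

lemma hnorm_le_of_energy_le {s t C : ℝ} (hC : 0 ≤ C) {u v : ℤ → ℂ} (hu : hsumm s u)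
    (h : energy t v ≤ ENNReal.ofReal C ^ 2 * energy s u) :
    hsumm t v ∧ hnorm t v ≤ C * hnorm s u := by
  rw [energy_eq hu, ← ENNReal.ofReal_pow hC, ← ENNReal.ofReal_mul (by positivity)] at h
  have hv : hsumm t v := hsumm_of_energy_ne_top (ne_top_of_le_ne_top ENNReal.ofReal_ne_top h)
  refine ⟨hv, ?_⟩
  rw [energy_eq hv, ENNReal.ofReal_le_ofReal_iff (by positivity), ← mul_pow] at h
  exact le_of_sq_le_sq h (mul_nonneg hC (hnorm_nonneg _ _))

lemma hnorm_le_of_norm_le {s t C : ℝ} (hC : 0 ≤ C) {u v : ℤ → ℂ} (hu : hsumm s u)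
    (h : ∀ j, ‖v j‖ * wt j ^ t ≤ C * (‖u j‖ * wt j ^ s)) :
    hsumm t v ∧ hnorm t v ≤ C * hnorm s u := by
  refine hnorm_le_of_energy_le hC hu ?_
  rw [energy, energy, ← ENNReal.tsum_mul_left]
  refine ENNReal.tsum_le_tsum fun j => ?_
  rw [← mul_pow, ← ENNReal.ofReal_mul hC]
  exact pow_le_pow_left' (ENNReal.ofReal_le_ofReal (h j)) 2

lemma sq_tsum_mul_le (x y : ℤ → ℝ≥0∞) :
    (∑' j, x j * y j) ^ 2 ≤ (∑' j, x j ^ 2) * ∑' j, y j ^ 2 := by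
  have h := ENNReal.lintegral_mul_le_Lp_mul_Lq (MeasureTheory.Measure.count (α := ℤ))
    Real.HolderConjugate.two_two (f := x) (g := y) (by fun_prop) (by fun_prop)
  simp only [MeasureTheory.lintegral_count, Pi.mul_apply] at h
  have h2 := pow_le_pow_left' h 2
  rw [mul_pow, ← ENNReal.rpow_natCast, ← ENNReal.rpow_natCast, ← ENNReal.rpow_mul,
    ← ENNReal.rpow_natCast, ← ENNReal.rpow_mul] at h2
  simpa using h2

lemma ennreal_add_sq_le (x y : ℝ≥0∞) : (x + y) ^ 2 ≤ 4 * (x ^ 2 + y ^ 2) := by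
  wlog h : x ≤ y generalizing x y
  · rw [add_comm x y, add_comm (x ^ 2)]
    exact this y x (le_of_not_ge h)
  calc (x + y) ^ 2 ≤ (2 * y) ^ 2 := by gcongr; rw [two_mul]; gcongr
    _ = 4 * y ^ 2 := by rw [mul_pow]; norm_num
    _ ≤ _ := by gcongr; exact le_add_self

lemma tsum_sub_left (n : ℤ) (x : ℤ → ℝ≥0∞) : ∑' j, x (n - j) = ∑' j, x j :=
  (Equiv.subLeft n).tsum_eq x

lemma tsum_sub_right (n : ℤ) (x : ℤ → ℝ≥0∞) : ∑' j, x (j - n) = ∑' j, x j :=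
  (Equiv.subRight n).tsum_eq x

lemma tsum_convolution_eq (x y : ℤ → ℝ≥0∞) :
    ∑' n : ℤ, ∑' j : ℤ, x (n - j) * y j = (∑' j, x j) * ∑' j, y j := by
  rw [ENNReal.tsum_comm]
  simp_rw [ENNReal.tsum_mul_right, tsum_sub_right]
  rw [ENNReal.tsum_mul_left]

lemma tsum_sq_kernel_le (b g w : ℤ → ℝ≥0∞) :
    ∑' n : ℤ, (∑' j : ℤ, b (n - j) * (g (n - j) + g j + g n) * w j) ^ 2 ≤
      36 * ((∑' j, g j ^ 2) * ((∑' j, b j ^ 2) * ∑' j, w j ^ 2)) := by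
  have hconv : ∑' n : ℤ, ∑' j : ℤ, (b (n - j) * w j) ^ 2 = (∑' j, b j ^ 2) * ∑' j, w j ^ 2 := by
    simp_rw [mul_pow]
    exact tsum_convolution_eq (fun j => b j ^ 2) (fun j => w j ^ 2)
  set G := ∑' j, g j ^ 2
  have h1 : ∀ n : ℤ, (∑' j : ℤ, g (n - j) * (b (n - j) * w j)) ^ 2 ≤
      G * ∑' j : ℤ, (b (n - j) * w j) ^ 2 := fun n => by
    refine (sq_tsum_mul_le _ _).trans_eq ?_
    rw [tsum_sub_left n (fun j => g j ^ 2)]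
  have h2 : ∀ n : ℤ, (∑' j : ℤ, g j * (b (n - j) * w j)) ^ 2 ≤
      G * ∑' j : ℤ, (b (n - j) * w j) ^ 2 := fun n => sq_tsum_mul_le _ _
  have h3 : ∀ n : ℤ, (∑' j : ℤ, g n * (b (n - j) * w j)) ^ 2 ≤
      g n ^ 2 * ((∑' j, b j ^ 2) * ∑' j, w j ^ 2) := fun n => by
    rw [ENNReal.tsum_mul_left, mul_pow]
    gcongr
    refine (sq_tsum_mul_le _ _).trans_eq ?_
    rw [tsum_sub_left n (fun j => b j ^ 2)]
  have hsplit : ∀ n : ℤ, (∑' j : ℤ, b (n - j) * (g (n - j) + g j + g n) * w j) ^ 2 ≤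
      4 * (4 * (G * ∑' j : ℤ, (b (n - j) * w j) ^ 2 + G * ∑' j : ℤ, (b (n - j) * w j) ^ 2) +
        g n ^ 2 * ((∑' j, b j ^ 2) * ∑' j, w j ^ 2)) := fun n => by
    have : ∑' j : ℤ, b (n - j) * (g (n - j) + g j + g n) * w j =
        (∑' j : ℤ, g (n - j) * (b (n - j) * w j) + ∑' j : ℤ, g j * (b (n - j) * w j)) +
          ∑' j : ℤ, g n * (b (n - j) * w j) := by
      rw [← ENNReal.tsum_add, ← ENNReal.tsum_add]
      congr with j
      ring
    rw [this]
    refine (ennreal_add_sq_le _ _).trans ?_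
    gcongr
    · refine (ennreal_add_sq_le _ _).trans ?_
      gcongr
      exacts [h1 n, h2 n]
    · exact h3 n
  refine (ENNReal.tsum_le_tsum hsplit).trans ?_
  simp_rw [ENNReal.tsum_mul_left, ENNReal.tsum_add, ENNReal.tsum_mul_left, ENNReal.tsum_add,
    ENNReal.tsum_mul_left, ENNReal.tsum_mul_right, hconv]
  change 4 * (4 * (G * _ + G * _) + G * _) ≤ _
  set X := G * ((∑' j, b j ^ 2) * ∑' j, w j ^ 2)
  exact le_of_eq (by ring)

/-- Discrete convolution of two-sided sequences. -/
def conv (a v : ℤ → ℂ) : ℤ → ℂ := fun n => ∑' j : ℤ, a (n - j) * v j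

lemma ofReal_norm_mul_mul_wt_le {t l : ℝ} (htl : |t| ≤ l) (a v : ℤ → ℂ) (n j : ℤ) :
    ENNReal.ofReal (‖a (n - j) * v j‖ * wt n ^ t) ≤
      ENNReal.ofReal (2 ^ |t|) * (ENNReal.ofReal (‖a (n - j)‖ * wt (n - j) ^ l) *
        (ENNReal.ofReal (wt (n - j) ^ (-l)) + ENNReal.ofReal (wt j ^ (-l)) +
          ENNReal.ofReal (wt n ^ (-l))) * ENNReal.ofReal (‖v j‖ * wt j ^ t)) := by
  have hn := wt_pos n
  have hj := wt_pos j
  have hm := wt_pos (n - j)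
  rw [← ENNReal.ofReal_add (by positivity) (by positivity),
    ← ENNReal.ofReal_add (by positivity) (by positivity), ← ENNReal.ofReal_mul (by positivity),
    ← ENNReal.ofReal_mul (by positivity), ← ENNReal.ofReal_mul (by positivity)]
  refine ENNReal.ofReal_le_ofReal ?_
  have h := wt_rpow_le htl n j
  have h1 : wt (n - j) ^ l * wt (n - j) ^ (-l) = 1 := by
    rw [← Real.rpow_add hm]; simp
  calc ‖a (n - j) * v j‖ * wt n ^ t
      ≤ ‖a (n - j) * v j‖ *
        (2 ^ |t| * wt j ^ t * (1 + wt (n - j) ^ l * (wt j ^ (-l) + wt n ^ (-l)))) := by gcongr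
    _ = _ := by rw [norm_mul, ← h1]; ring

lemma tsum_sq_wt_ne_top {l : ℝ} (hl : 1 ≤ l) :
    ∑' j : ℤ, ENNReal.ofReal (wt j ^ (-l)) ^ 2 ≠ ⊤ := by
  simp_rw [← ENNReal.ofReal_pow (wt_rpow_nonneg _ _), wt_rpow_sq]
  exact (summable_wt_rpow hl).tsum_ofReal_ne_top

/-- Multiplication by an `H^l` function is bounded on `H^t` for `l ≥ 1`, `|t| ≤ l`. -/
lemma exists_conv_bound {t l : ℝ} (hl : 1 ≤ l) (htl : |t| ≤ l) {a : ℤ → ℂ} (ha : hsumm l a) :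
    ∃ C : ℝ, 0 ≤ C ∧ ∀ v : ℤ → ℂ, hsumm t v → (∀ n, Summable fun j => a (n - j) * v j) ∧
      hsumm t (conv a v) ∧ hnorm t (conv a v) ≤ C * hnorm t v := by
  set G := ∑' j : ℤ, ENNReal.ofReal (wt j ^ (-l)) ^ 2 with hG
  have hGtop : G ≠ ⊤ := tsum_sq_wt_ne_top hl
  have hatop : energy l a ≠ ⊤ := by rw [energy_eq ha]; exact ENNReal.ofReal_ne_top
  set Q : ℝ≥0∞ := ENNReal.ofReal (2 ^ |t|) ^ 2 * (36 * (G * energy l a)) with hQ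
  have hQtop : Q ≠ ⊤ := by
    rw [hQ]
    exact ENNReal.mul_ne_top (ENNReal.pow_ne_top ENNReal.ofReal_ne_top)
      (ENNReal.mul_ne_top (by norm_num) (ENNReal.mul_ne_top hGtop hatop))
  refine ⟨√Q.toReal, Real.sqrt_nonneg _, fun v hv => ?_⟩
  have key : ∑' n : ℤ, (∑' j : ℤ, ENNReal.ofReal (‖a (n - j) * v j‖ * wt n ^ t)) ^ 2 ≤
      Q * energy t v := by
    calc _ ≤ ∑' n : ℤ, (∑' j : ℤ, ENNReal.ofReal (2 ^ |t|) *
          (ENNReal.ofReal (‖a (n - j)‖ * wt (n - j) ^ l) *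
          (ENNReal.ofReal (wt (n - j) ^ (-l)) + ENNReal.ofReal (wt j ^ (-l)) +
            ENNReal.ofReal (wt n ^ (-l))) * ENNReal.ofReal (‖v j‖ * wt j ^ t))) ^ 2 :=
          ENNReal.tsum_le_tsum fun n => pow_le_pow_left' (ENNReal.tsum_le_tsum fun j =>
            ofReal_norm_mul_mul_wt_le htl a v n j) 2
      _ ≤ ENNReal.ofReal (2 ^ |t|) ^ 2 * (36 * (G * (energy l a * energy t v))) := by
          simp_rw [ENNReal.tsum_mul_left, mul_pow, ENNReal.tsum_mul_left]
          gcongr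
          exact tsum_sq_kernel_le (fun j => ENNReal.ofReal (‖a j‖ * wt j ^ l))
            (fun j => ENNReal.ofReal (wt j ^ (-l))) (fun j => ENNReal.ofReal (‖v j‖ * wt j ^ t))
      _ = _ := by rw [hQ]; ring
  have hvtop : energy t v ≠ ⊤ := by rw [energy_eq hv]; exact ENNReal.ofReal_ne_top
  have hterm : ∀ n : ℤ, ∑' j : ℤ, ENNReal.ofReal (‖a (n - j) * v j‖ * wt n ^ t) =
      (∑' j : ℤ, ‖a (n - j) * v j‖ₑ) * ENNReal.ofReal (wt n ^ t) := fun n => by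
    simp_rw [ENNReal.ofReal_mul (norm_nonneg _), ENNReal.tsum_mul_right, ofReal_norm]
  refine ⟨fun n => ?_, ?_⟩
  · have h1 : (∑' j : ℤ, ENNReal.ofReal (‖a (n - j) * v j‖ * wt n ^ t)) ^ 2 ≠ ⊤ :=
      ENNReal.ne_top_of_tsum_ne_top
        (ne_top_of_le_ne_top (ENNReal.mul_ne_top hQtop hvtop) key) n
    have h2 : ∑' j : ℤ, ENNReal.ofReal (‖a (n - j) * v j‖ * wt n ^ t) ≠ ⊤ := by
      intro h
      rw [h] at h1
      simp at h1
    rw [hterm] at h2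
    refine Summable.of_enorm fun h => h2 ?_
    rw [h, ENNReal.top_mul]
    simpa using Real.rpow_pos_of_pos (wt_pos n) t
  · refine hnorm_le_of_energy_le (Real.sqrt_nonneg _) hv ?_
    rw [← ENNReal.ofReal_pow (Real.sqrt_nonneg _), Real.sq_sqrt ENNReal.toReal_nonneg,
      ENNReal.ofReal_toReal hQtop]
    refine le_trans (ENNReal.tsum_le_tsum fun n => pow_le_pow_left' ?_ 2) key
    rw [hterm, ENNReal.ofReal_mul (norm_nonneg _), ofReal_norm]
    gcongr
    exact enorm_tsum_le_tsum_enorm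

/-- The isometric parametrization of `H^s` by `ℓ²`. -/
def ofLp (s : ℝ) : lp (fun _ : ℤ => ℂ) 2 →ₗ[ℂ] (ℤ → ℂ) where
  toFun x j := ((wt j ^ (-s) : ℝ) : ℂ) * x j
  map_add' x y := by ext j; simp [mul_add]
  map_smul' c x := by ext j; simp [mul_left_comm]

lemma norm_ofLp_sq_mul (s : ℝ) (x : lp (fun _ : ℤ => ℂ) 2) (j : ℤ) :
    ‖ofLp s x j‖ ^ 2 * wt j ^ (2 * s) = ‖x j‖ ^ (2 : ℝ≥0∞).toReal := by
  have h := wt_rpow_nonneg j (-s)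
  have h1 : wt j ^ (-s) * wt j ^ s = 1 := by rw [← Real.rpow_add (wt_pos j)]; simp
  have h2 : ‖ofLp s x j‖ = wt j ^ (-s) * ‖x j‖ := by
    simp [ofLp, abs_of_nonneg h]
  rw [h2, ← wt_rpow_sq]
  calc _ = (wt j ^ (-s) * wt j ^ s) ^ 2 * ‖x j‖ ^ 2 := by ring
    _ = _ := by rw [h1]; norm_num

lemma hsumm_ofLp (s : ℝ) (x : lp (fun _ : ℤ => ℂ) 2) : hsumm s (ofLp s x) := by
  simp_rw [hsumm, norm_ofLp_sq_mul]
  exact (memℓp_gen_iff (by norm_num)).1 (lp.memℓp x)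

lemma hnorm_ofLp (s : ℝ) (x : lp (fun _ : ℤ => ℂ) 2) : hnorm s (ofLp s x) = ‖x‖ := by
  rw [lp.norm_eq_tsum_rpow (by norm_num), hnorm, Real.sqrt_eq_rpow]
  simp_rw [norm_ofLp_sq_mul]
  norm_num

lemma exists_ofLp_eq {s : ℝ} {u : ℤ → ℂ} (hu : hsumm s u) : ∃ x, ofLp s x = u := by
  have h : ∀ j, ‖((wt j ^ s : ℝ) : ℂ) * u j‖ ^ (2 : ℝ≥0∞).toReal = ‖u j‖ ^ 2 * wt j ^ (2 * s) :=
    fun j => by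
      simp [abs_of_nonneg (wt_rpow_nonneg j s), mul_pow, wt_rpow_sq, mul_comm]
  have hmem : Memℓp (fun j => ((wt j ^ s : ℝ) : ℂ) * u j) 2 := by
    rw [memℓp_gen_iff (by norm_num)]
    simp_rw [h]
    exact hu
  refine ⟨⟨_, hmem⟩, ?_⟩
  ext j
  have h1 : wt j ^ (-s) * wt j ^ s = 1 := by rw [← Real.rpow_add (wt_pos j)]; simp
  change ((wt j ^ (-s) : ℝ) : ℂ) * (((wt j ^ s : ℝ) : ℂ) * u j) = u j
  rw [← mul_assoc, ← Complex.ofReal_mul, h1]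
  simp

lemma ofLp_injective (s : ℝ) : Function.Injective (ofLp s) := by
  rw [injective_iff_map_eq_zero]
  intro x hx
  rw [← norm_eq_zero, ← hnorm_ofLp s x, hx]
  simp [hnorm]

lemma hsumm.add {s : ℝ} {u v : ℤ → ℂ} (hu : hsumm s u) (hv : hsumm s v) : hsumm s (u + v) := by
  obtain ⟨x, rfl⟩ := exists_ofLp_eq hu
  obtain ⟨y, rfl⟩ := exists_ofLp_eq hv
  rw [← map_add]
  exact hsumm_ofLp s _

lemma hsumm.smul {s : ℝ} {u : ℤ → ℂ} (hu : hsumm s u) (z : ℂ) : hsumm s (z • u) := by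
  obtain ⟨x, rfl⟩ := exists_ofLp_eq hu
  rw [← map_smul]
  exact hsumm_ofLp s _

lemma hsumm.sub {s : ℝ} {u v : ℤ → ℂ} (hu : hsumm s u) (hv : hsumm s v) : hsumm s (u - v) := by
  simpa [sub_eq_add_neg] using hu.add (hv.smul (-1))

lemma hnorm_add_le {s : ℝ} {u v : ℤ → ℂ} (hu : hsumm s u) (hv : hsumm s v) :
    hnorm s (u + v) ≤ hnorm s u + hnorm s v := by
  obtain ⟨x, rfl⟩ := exists_ofLp_eq hu
  obtain ⟨y, rfl⟩ := exists_ofLp_eq hv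
  rw [← map_add]
  simpa only [hnorm_ofLp] using norm_add_le x y

lemma hnorm_zero (s : ℝ) : hnorm s 0 = 0 := by simp [hnorm]

lemma hsumm_zero (s : ℝ) : hsumm s 0 := by simpa using hsumm_ofLp s 0

lemma eq_zero_of_hnorm_le_zero {s : ℝ} {u : ℤ → ℂ} (hu : hsumm s u) (h : hnorm s u ≤ 0) :
    u = 0 := by
  obtain ⟨x, rfl⟩ := exists_ofLp_eq hu
  rw [hnorm_ofLp, norm_le_zero_iff] at h
  simp [h]

/-- Boundedness of a map between Sobolev spaces. -/
def IsSobolevBounded (s t : ℝ) (T : (ℤ → ℂ) → (ℤ → ℂ)) : Prop :=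
  ∃ C : ℝ, 0 ≤ C ∧ ∀ u : ℤ → ℂ, hsumm s u → hsumm t (T u) ∧ hnorm t (T u) ≤ C * hnorm s u

namespace IsSobolevBounded

variable {r s t : ℝ} {S T : (ℤ → ℂ) → (ℤ → ℂ)}

lemma hsumm_apply (hT : IsSobolevBounded s t T) {u : ℤ → ℂ} (hu : hsumm s u) : hsumm t (T u) :=
  hT.choose_spec.2 u hu |>.1

lemma hnorm_le (hT : IsSobolevBounded s t T) {u : ℤ → ℂ} (hu : hsumm s u) :
    hnorm t (T u) ≤ opNorm s t T * hnorm s u := by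
  obtain ⟨C, hC, h⟩ := hT
  rcases (hnorm_nonneg s u).eq_or_lt with h0 | h0
  · simpa [← h0] using (h u hu).2
  · rw [← div_le_iff₀ h0]
    exact le_csInf ⟨C, hC, fun v hv => (h v hv).2⟩ fun B hB => (div_le_iff₀ h0).2 (hB.2 u hu)

lemma comp (hS : IsSobolevBounded s t S) (hT : IsSobolevBounded r s T) : IsSobolevBounded r t fun u => S (T u) := by
  obtain ⟨A, hA, hS⟩ := hS
  obtain ⟨B, hB, hT⟩ := hT
  refine ⟨A * B, by positivity, fun u hu => ⟨(hS _ (hT u hu).1).1, ?_⟩⟩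
  calc hnorm t (S (T u)) ≤ A * hnorm s (T u) := (hS _ (hT u hu).1).2
    _ ≤ A * (B * hnorm r u) := by gcongr; exact (hT u hu).2
    _ = _ := by ring

lemma add (hS : IsSobolevBounded s t S) (hT : IsSobolevBounded s t T) : IsSobolevBounded s t fun u => S u + T u := by
  obtain ⟨A, hA, hS⟩ := hS
  obtain ⟨B, hB, hT⟩ := hT
  refine ⟨A + B, by positivity, fun u hu => ⟨(hS u hu).1.add (hT u hu).1, ?_⟩⟩
  refine (hnorm_add_le (hS u hu).1 (hT u hu).1).trans ?_
  linarith [(hS u hu).2, (hT u hu).2]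

lemma sum {ι : Type*} (F : Finset ι) {R : ι → (ℤ → ℂ) → (ℤ → ℂ)}
    (hR : ∀ i ∈ F, IsSobolevBounded s t (R i)) : IsSobolevBounded s t fun u => ∑ i ∈ F, R i u := by
  classical
  induction F using Finset.induction_on with
  | empty => exact ⟨0, le_rfl, fun u _ => by simp [hnorm_zero, hsumm_zero]⟩
  | insert i F hi ih =>
    simp_rw [Finset.sum_insert hi]
    exact (hR i (by simp)).add (ih fun k hk => hR k (by simp [hk]))

/-- A Fourier multiplier with symbol of order `s - t` is bounded from `H^s` to `H^t`. -/
lemma multiplier {m : ℤ → ℂ} {C : ℝ} (hm : ∀ j, ‖m j‖ ≤ C * wt j ^ (s - t)) :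
    IsSobolevBounded s t fun u j => m j * u j := by
  have hC : 0 ≤ C := by simpa [wt] using (norm_nonneg _).trans (hm 0)
  refine ⟨C, hC, fun u hu => hnorm_le_of_norm_le hC hu fun j => ?_⟩
  have h : wt j ^ (s - t) * wt j ^ t = wt j ^ s := by rw [← Real.rpow_add (wt_pos j)]; simp
  have := wt_rpow_nonneg j t
  calc ‖m j * u j‖ * wt j ^ t = ‖m j‖ * (‖u j‖ * wt j ^ t) := by rw [norm_mul]; ring
    _ ≤ C * wt j ^ (s - t) * (‖u j‖ * wt j ^ t) := by gcongr; exact hm j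
    _ = _ := by rw [← h]; ring

/-- The bounded inverse theorem in Sobolev spaces. -/
lemma inverse (hS : IsSobolevBounded s t S)
    (hadd : ∀ u v, hsumm s u → hsumm s v → S (u + v) = S u + S v)
    (hsmul : ∀ (z : ℂ) (u), hsumm s u → S (z • u) = z • S u)
    (hT : ∀ f, hsumm t f → hsumm s (T f) ∧ S (T f) = f)
    (hTS : ∀ u, hsumm s u → T (S u) = u) : IsSobolevBounded t s T := by
  choose F hF using fun x => exists_ofLp_eq (hS.hsumm_apply (hsumm_ofLp s x))
  let A : lp (fun _ : ℤ => ℂ) 2 →ₗ[ℂ] lp (fun _ : ℤ => ℂ) 2 :=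
    { toFun := F
      map_add' := fun x y => ofLp_injective t <| by
        rw [map_add, hF, hF, hF, map_add, hadd _ _ (hsumm_ofLp s x) (hsumm_ofLp s y)]
      map_smul' := fun z x => ofLp_injective t <| by
        rw [RingHom.id_apply, map_smul, hF, hF, map_smul, hsmul _ _ (hsumm_ofLp s x)] }
  let A' := A.mkContinuousOfExistsBound ⟨opNorm s t S, fun x => by
    have := hS.hnorm_le (hsumm_ofLp s x)
    rwa [← hF, hnorm_ofLp, hnorm_ofLp] at this⟩
  have hsurj : Function.Surjective A' := fun y => by
    obtain ⟨h1, h2⟩ := hT _ (hsumm_ofLp t y)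
    obtain ⟨x, hx⟩ := exists_ofLp_eq h1
    refine ⟨x, ofLp_injective t ?_⟩
    change ofLp t (F x) = _
    rw [hF, hx, h2]
  obtain ⟨C, hC, h⟩ := A'.exists_preimage_norm_le hsurj
  refine ⟨C, hC.le, fun f hf => ⟨(hT f hf).1, ?_⟩⟩
  obtain ⟨y, rfl⟩ := exists_ofLp_eq hf
  obtain ⟨x, hx, hxy⟩ := h y
  have : ofLp t y = S (ofLp s x) := by rw [← hx]; exact hF x
  rw [hnorm_ofLp, this, hTS _ (hsumm_ofLp s x), hnorm_ofLp]
  exact hxy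

end IsSobolevBounded

lemma opNorm_nonneg (s t : ℝ) (T : (ℤ → ℂ) → (ℤ → ℂ)) : 0 ≤ opNorm s t T :=
  Real.sInf_nonneg fun _ h => h.1

lemma IsSobolevBounded.opNorm_pos {s t : ℝ} {T : (ℤ → ℂ) → (ℤ → ℂ)} (hT : IsSobolevBounded s t T)
    {u : ℤ → ℂ} (hu : hsumm s u) (h : T u ≠ 0) : 0 < opNorm s t T := by
  refine (opNorm_nonneg s t T).lt_of_ne' fun h0 => h ?_
  refine eq_zero_of_hnorm_le_zero (hT.hsumm_apply hu) ?_
  simpa [h0] using hT.hnorm_le hu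

lemma L0op_add (q k : ℕ) (c : ℕ → ℂ) (u v : ℤ → ℂ) :
    L0op q k c (u + v) = L0op q k c u + L0op q k c v := by
  ext j; simp [L0op, mul_add]

lemma L0op_smul (q k : ℕ) (c : ℕ → ℂ) (z : ℂ) (u : ℤ → ℂ) :
    L0op q k c (z • u) = z • L0op q k c u := by
  ext j; simp [L0op, mul_left_comm]

lemma norm_I_mul_pow_le {r k : ℕ} (hr : r ≤ k) (j : ℤ) :
    ‖(Complex.I * (j : ℂ)) ^ r‖ ≤ wt j ^ (k : ℝ) := by
  rw [Real.rpow_natCast, norm_pow, norm_mul, Complex.norm_I, one_mul, Complex.norm_intCast]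
  exact (pow_le_pow_left₀ (abs_nonneg _) (le_max_right _ _) r).trans
    (pow_le_pow_right₀ (one_le_wt j) hr)

lemma norm_symb_le (q k : ℕ) (c : ℕ → ℂ) (j : ℤ) :
    ‖symb q k c j‖ ≤ (∑ r ∈ Finset.Icc q k, ‖c r‖) * wt j ^ (k : ℝ) := by
  rw [symb, Finset.sum_mul]
  refine (norm_sum_le _ _).trans (Finset.sum_le_sum fun r hr => ?_)
  rw [norm_mul]
  gcongr
  exact norm_I_mul_pow_le (Finset.mem_Icc.1 hr).2 j

lemma isSobolevBounded_L0op (s : ℝ) (q k : ℕ) (c : ℕ → ℂ) :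
    IsSobolevBounded s (s - k) (L0op q k c) :=
  .multiplier fun j => by simpa using norm_symb_le q k c j

lemma isSobolevBounded_symb_sub (s : ℝ) (q k : ℕ) (c : ℕ → ℂ) (ζ : ℂ) :
    IsSobolevBounded s (s - k) fun u j => (symb q k c j - ζ) * u j :=
  .multiplier (C := (∑ r ∈ Finset.Icc q k, ‖c r‖) + ‖ζ‖) fun j => by
    have h1 : 1 ≤ wt j ^ (k : ℝ) := Real.one_le_rpow (one_le_wt j) (by positivity)
    have h2 := mul_le_mul_of_nonneg_left h1 (norm_nonneg ζ)
    have h3 := norm_symb_le q k c j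
    have h4 := norm_sub_le (symb q k c j) ζ
    rw [sub_sub_cancel]
    linarith

lemma zetaGood.sub_ne_zero {q k : ℕ} {c : ℕ → ℂ} {ζ : ℂ} (hζ : zetaGood q k c ζ) (j : ℤ) :
    symb q k c j - ζ ≠ 0 := by
  obtain ⟨ε, hε, h⟩ := hζ
  intro h0
  have := h j
  simp only [h0, norm_zero, zero_mul] at this
  linarith

lemma zetaGood.exists_le_norm {q k : ℕ} {c : ℕ → ℂ} {ζ : ℂ} (hζ : zetaGood q k c ζ) :
    ∃ ε : ℝ, 0 < ε ∧ ∀ j, ε * wt j ^ (k : ℝ) ≤ ‖symb q k c j - ζ‖ := by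
  obtain ⟨ε, hε, h⟩ := hζ
  refine ⟨ε, hε, fun j => ?_⟩
  have h1 := h j
  rwa [Real.rpow_neg (wt_pos j).le, ← div_eq_mul_inv,
    le_div_iff₀ (Real.rpow_pos_of_pos (wt_pos j) _)] at h1

lemma zetaGood.exists_symb_ne_zero {q k : ℕ} {c : ℕ → ℂ} {ζ : ℂ} (hζ : zetaGood q k c ζ)
    (hk : 1 ≤ k) : ∃ j, symb q k c j ≠ 0 := by
  obtain ⟨ε, hε, h⟩ := hζ.exists_le_norm
  by_contra! h0
  obtain ⟨n, hn⟩ := exists_nat_gt (‖ζ‖ / ε)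
  rw [div_lt_iff₀ hε] at hn
  have h1 := h n
  rw [h0, zero_sub, norm_neg, Real.rpow_natCast] at h1
  have h2 : (n : ℝ) ≤ wt n := by simp [wt]
  have h3 : wt n ≤ wt n ^ k := le_self_pow₀ (one_le_wt n) (by omega)
  nlinarith

lemma isSobolevBounded_Nop (s : ℝ) {q k : ℕ} {c : ℕ → ℂ} {ζ : ℂ} (hζ : zetaGood q k c ζ) :
    IsSobolevBounded (s - k) s (Nop q k c ζ) := by
  obtain ⟨ε, hε, h⟩ := hζ.exists_le_norm
  refine .multiplier (C := ε⁻¹) fun j => ?_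
  have hw := Real.rpow_pos_of_pos (wt_pos j) (k : ℝ)
  rw [norm_inv, sub_sub_cancel_left, Real.rpow_neg (wt_pos j).le, ← mul_inv]
  exact inv_anti₀ (by positivity) (h j)

lemma isSobolevBounded_id {s t : ℝ} (hts : t ≤ s) : IsSobolevBounded s t fun u => u := by
  have h : IsSobolevBounded s t fun u j => (1 : ℂ) * u j := .multiplier (C := 1) fun j => by
    simpa using Real.one_le_rpow (one_le_wt j) (sub_nonneg.2 hts)
  simpa only [one_mul] using h

lemma isSobolevBounded_projP {s t : ℝ} (hts : t ≤ s) (N : ℕ) :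
    IsSobolevBounded s t (projP N) := by
  refine ⟨1, zero_le_one, fun u hu => hnorm_le_of_norm_le zero_le_one hu fun j => ?_⟩
  rw [one_mul]
  have h1 : ‖projP N u j‖ ≤ ‖u j‖ := by
    unfold projP
    split_ifs <;> simp
  exact mul_le_mul h1 (Real.rpow_le_rpow_of_exponent_le (one_le_wt j) hts)
    (wt_rpow_nonneg j t) (norm_nonneg _)

lemma isSobolevBounded_sub_projP {s t : ℝ} (hts : t ≤ s) (N : ℕ) :
    IsSobolevBounded s t fun u => u - projP N u := by
  refine ⟨1, zero_le_one, fun u hu => hnorm_le_of_norm_le zero_le_one hu fun j => ?_⟩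
  rw [one_mul]
  have h1 : ‖(u - projP N u) j‖ ≤ ‖u j‖ := by
    simp only [projP, Pi.sub_apply]
    split_ifs <;> simp
  exact mul_le_mul h1 (Real.rpow_le_rpow_of_exponent_le (one_le_wt j) hts)
    (wt_rpow_nonneg j t) (norm_nonneg _)

lemma L1op_eq_sum_conv (p : ℕ) (a : ℕ → ℤ → ℂ) (u : ℤ → ℂ) :
    L1op p a u =
      ∑ r ∈ Finset.range (p + 1), conv (a r) fun j => (Complex.I * (j : ℂ)) ^ r * u j := by
  ext n
  simp [L1op, conv, mul_assoc]

lemma isSobolevBounded_I_mul_pow {s : ℝ} {r p : ℕ} (hr : r ≤ p) :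
    IsSobolevBounded s (s - p) fun u j => (Complex.I * (j : ℂ)) ^ r * u j :=
  .multiplier (C := 1) fun j => by
    rw [sub_sub_cancel, one_mul]
    exact norm_I_mul_pow_le hr j

section VariableCoefficients

variable {s l : ℝ} {p : ℕ} {a : ℕ → ℤ → ℂ}

lemma isSobolevBounded_L1op (hl : 1 ≤ l) (htl : |s - p| ≤ l) (ha : ∀ r, r ≤ p → hsumm l (a r)) :
    IsSobolevBounded s (s - p) (L1op p a) := by
  rw [funext (L1op_eq_sum_conv p a)]
  refine .sum _ fun r hr => ?_
  have hr : r ≤ p := by simpa [Nat.lt_succ_iff] using hr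
  obtain ⟨C, hC, h⟩ := exists_conv_bound hl htl (ha r hr)
  have hconv : IsSobolevBounded (s - p) (s - p) (conv (a r)) :=
    ⟨C, hC, fun v hv => (h v hv).2⟩
  exact hconv.comp (isSobolevBounded_I_mul_pow hr)

lemma L1op_add (hl : 1 ≤ l) (htl : |s - p| ≤ l) (ha : ∀ r, r ≤ p → hsumm l (a r))
    {u v : ℤ → ℂ} (hu : hsumm s u) (hv : hsumm s v) :
    L1op p a (u + v) = L1op p a u + L1op p a v := by
  simp_rw [L1op_eq_sum_conv]
  rw [← Finset.sum_add_distrib]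
  refine Finset.sum_congr rfl fun r hr => ?_
  have hr : r ≤ p := by simpa [Nat.lt_succ_iff] using hr
  obtain ⟨C, hC, h⟩ := exists_conv_bound hl htl (ha r hr)
  have hd := isSobolevBounded_I_mul_pow (s := s) hr
  ext n
  have h1 := (h _ (hd.hsumm_apply hu)).1 n
  have h2 := (h _ (hd.hsumm_apply hv)).1 n
  simp only [conv, Pi.add_apply]
  rw [← h1.tsum_add h2]
  simp_rw [mul_add]

end VariableCoefficients

lemma L1op_smul (p : ℕ) (a : ℕ → ℤ → ℂ) (z : ℂ) (u : ℤ → ℂ) :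
    L1op p a (z • u) = z • L1op p a u := by
  simp_rw [L1op_eq_sum_conv]
  rw [Finset.smul_sum]
  refine Finset.sum_congr rfl fun r _ => ?_
  ext n
  simp only [conv, Pi.smul_apply, smul_eq_mul]
  rw [← tsum_mul_left]
  congr with j
  ring

lemma projP_add (N : ℕ) (u v : ℤ → ℂ) : projP N (u + v) = projP N u + projP N v := by
  ext j
  simp only [projP, Pi.add_apply]
  split_ifs <;> simp

lemma projP_smul (N : ℕ) (z : ℂ) (u : ℤ → ℂ) : projP N (z • u) = z • projP N u := by
  ext j
  simp [projP]

lemma projP_projP (N : ℕ) (u : ℤ → ℂ) : projP N (projP N u) = projP N u := by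
  ext j
  simp only [projP]
  split_ifs <;> simp

lemma projP_L0op (N q k : ℕ) (c : ℕ → ℂ) (u : ℤ → ℂ) :
    projP N (L0op q k c u) = L0op q k c (projP N u) := by
  ext j
  simp [projP, L0op]

lemma inPN.apply_eq_zero {N : ℕ} {u : ℤ → ℂ} (hu : inPN N u) {j : ℤ}
    (hj : j ∉ Finset.Icc (-Nmin N) (Npl N)) : u j = 0 := by
  rw [Finset.mem_Icc] at hj
  rw [← congrFun hu j, projP, if_neg hj]

lemma inPN.hsumm {N : ℕ} {u : ℤ → ℂ} (hu : inPN N u) {s : ℝ} : hsumm s u :=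
  summable_of_ne_finset_zero (s := Finset.Icc (-Nmin N) (Npl N)) fun j hj => by
    simp [hu.apply_eq_zero hj]

lemma norm_sub_projP_le {N : ℕ} {v : ℤ → ℂ} (hv : inPN N v) (u : ℤ → ℂ) (j : ℤ) :
    ‖(u - projP N u) j‖ ≤ ‖(u - v) j‖ := by
  by_cases hj : -Nmin N ≤ j ∧ j ≤ Npl N
  · simp [projP, hj]
  · simp [projP, hj, hv.apply_eq_zero (mt Finset.mem_Icc.1 hj)]

/-- The range of `𝒫_N` as a subspace. -/
def rangeProjP (N : ℕ) : Submodule ℂ (ℤ → ℂ) where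
  carrier := {u | inPN N u}
  add_mem' {u v} hu hv := by
    change projP N (u + v) = u + v
    rw [projP_add, hu, hv]
  zero_mem' := by
    change projP N 0 = 0
    ext j
    simp [projP]
  smul_mem' z u hu := by
    change projP N (z • u) = z • u
    rw [projP_smul, hu]

instance (N : ℕ) : FiniteDimensional ℂ (rangeProjP N) := by
  refine FiniteDimensional.of_injective
    ((LinearMap.funLeft ℂ ℂ (Subtype.val : Finset.Icc (-Nmin N) (Npl N) → ℤ)).comp
      (rangeProjP N).subtype) ?_
  rw [injective_iff_map_eq_zero]
  intro u hu
  ext j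
  by_cases hj : j ∈ Finset.Icc (-Nmin N) (Npl N)
  · exact congrFun hu ⟨j, hj⟩
  · exact inPN.apply_eq_zero u.2 hj

lemma existsUnique_of_inPN {N : ℕ} {T : (ℤ → ℂ) → (ℤ → ℂ)} (hT : ∀ u, inPN N u → inPN N (T u))
    (hadd : ∀ u v, inPN N u → inPN N v → T (u + v) = T u + T v)
    (hsmul : ∀ (z : ℂ) (u), T (z • u) = z • T u) (hker : ∀ u, inPN N u → T u = 0 → u = 0)
    (f : ℤ → ℂ) (hf : inPN N f) : ∃! u, inPN N u ∧ T u = f := by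
  let A : rangeProjP N →ₗ[ℂ] rangeProjP N :=
    { toFun := fun u => ⟨T u, hT u u.2⟩
      map_add' := fun u v => Subtype.ext (hadd u v u.2 v.2)
      map_smul' := fun z u => Subtype.ext (hsmul z u) }
  have hinj : Function.Injective A := by
    rw [injective_iff_map_eq_zero]
    exact fun u hu => Subtype.ext (hker u u.2 (congrArg Subtype.val hu))
  obtain ⟨u, hu⟩ := LinearMap.injective_iff_surjective.1 hinj ⟨f, hf⟩
  refine ⟨u, ⟨u.2, congrArg Subtype.val hu⟩, fun v ⟨hv, hvf⟩ => ?_⟩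
  exact congrArg Subtype.val (@hinj ⟨v, hv⟩ u (hu ▸ Subtype.ext hvf))

/-- Convergence of the finite-section method for the periodic differential
operator `𝓛 = 𝓛₀ + 𝓛₁ : H^s → H^{s-k}`, at the optimal rate. -/
theorem finite_section_differential_operator
    (s : ℝ) (q k p l : ℕ) (hqk : q ≤ k) (hpk : p < k) (hl : 1 ≤ l)
    (c : ℕ → ℂ) (hck : c k ≠ 0)
    (a : ℕ → ℤ → ℂ) (ha : ∀ r, r ≤ p → hsumm (l : ℝ) (a r))
    (ζ : ℂ) (hζ : zetaGood q k c ζ)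
    (hlreg : max (max |s - (p : ℝ)| (p : ℝ)) 1 ≤ (l : ℝ))
    -- `𝓛 : H^s → H^{s-k}` is invertible, with inverse `Linv`
    (Linv : (ℤ → ℂ) → (ℤ → ℂ))
    (hLinv₁ : ∀ f : ℤ → ℂ, hsumm (s - (k : ℝ)) f →
      hsumm s (Linv f) ∧ L0op q k c (Linv f) + L1op p a (Linv f) = f)
    (hLinv₂ : ∀ u : ℤ → ℂ, hsumm s u → Linv (L0op q k c u + L1op p a u) = u)
    -- `D = D_{s-p,s-k}` is a constant with `‖id - 𝒫_N‖_{s-p → s-k} ≤ D N^{p-k}`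
    (D : ℝ)
    (hD : ∀ N : ℕ, 1 ≤ N →
      opNorm (s - (p : ℝ)) (s - (k : ℝ)) (fun u => u - projP N u)
        ≤ D * (N : ℝ) ^ ((p : ℝ) - (k : ℝ))) :
    ∃ ccon Ccon : ℝ, 0 < ccon ∧ 0 < Ccon ∧
      Ccon ≤ 2 * opNorm s s (fun f => Linv (fun j => (symb q k c j - ζ) * f j))
              * opNorm (s - (k : ℝ)) s (Nop q k c ζ) * opNorm s (s - (k : ℝ)) (L0op q k c) ∧
      ∀ N : ℕ, 1 ≤ N →
        opNorm (s - (k : ℝ)) s (Nop q k c ζ) * D * (N : ℝ) ^ ((p : ℝ) - (k : ℝ))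
            * opNorm s (s - (p : ℝ)) (L1op p a)
          < (1 / 2) * (opNorm s s (fun f => Linv (fun j => (symb q k c j - ζ) * f j)))⁻¹ →
        ∀ f : ℤ → ℂ, hsumm (s - (k : ℝ)) f →
          -- the operator `𝓛₀ + 𝒫_N 𝓛₁ : ran 𝒫_N → ran 𝒫_N` is invertible
          (∀ f' : ℤ → ℂ, inPN N f' →
            ∃! uN : ℤ → ℂ, inPN N uN ∧ L0op q k c uN + projP N (L1op p a uN) = f') ∧
          -- and the unique solution `u_N ∈ ran 𝒫_N` of `(𝓛₀ + 𝒫_N 𝓛₁) u_N = 𝒫_N f` satisfies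
          -- `c ‖u - 𝒫_N u‖_s ≤ ‖u - u_N‖_s ≤ C ‖u - 𝒫_N u‖_s` with `u = 𝓛⁻¹ f`
          (∀ uN : ℤ → ℂ, inPN N uN →
            L0op q k c uN + projP N (L1op p a uN) = projP N f →
            ccon * hnorm s (Linv f - projP N (Linv f)) ≤ hnorm s (Linv f - uN) ∧
            hnorm s (Linv f - uN) ≤ Ccon * hnorm s (Linv f - projP N (Linv f))) := by
  have hl1 : (1 : ℝ) ≤ l := by exact_mod_cast hl
  have htl : |s - (p : ℝ)| ≤ l := (le_max_left _ _).trans ((le_max_left _ _).trans hlreg)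
  have hkp : (p : ℝ) ≤ k := by exact_mod_cast hpk.le
  have hne : ∀ j, symb q k c j - ζ ≠ 0 := hζ.sub_ne_zero
  have bL0 : IsSobolevBounded s (s - k) (L0op q k c) := isSobolevBounded_L0op s q k c
  have bN : IsSobolevBounded (s - k) s (Nop q k c ζ) := isSobolevBounded_Nop s hζ
  have bL1 : IsSobolevBounded s (s - p) (L1op p a) := isSobolevBounded_L1op hl1 htl ha
  have bL1' : IsSobolevBounded s (s - k) (L1op p a) :=
    (isSobolevBounded_id (by linarith)).comp bL1
  have bLinv : IsSobolevBounded (s - k) s Linv := by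
    refine (bL0.add bL1').inverse (fun u v hu hv => ?_) (fun z u _ => ?_) hLinv₁ hLinv₂
    · rw [L0op_add, L1op_add hl1 htl ha hu hv, add_add_add_comm]
    · rw [L0op_smul, L1op_smul, smul_add]
  have bT : IsSobolevBounded s s fun f => Linv fun j => (symb q k c j - ζ) * f j :=
    bLinv.comp (isSobolevBounded_symb_sub s q k c ζ)
  set M := opNorm s s fun f => Linv fun j => (symb q k c j - ζ) * f j
  set ν := opNorm (s - k) s (Nop q k c ζ)
  set lam := opNorm s (s - k) (L0op q k c)
  have hinv : ∀ g : ℤ → ℂ, (fun j => (symb q k c j - ζ) * Nop q k c ζ g j) = g := fun g => by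
    ext j
    simp [Nop, mul_inv_cancel_left₀ (hne j)]
  set δ : ℤ → ℂ := Pi.single 0 1
  have hδ : ∀ t, hsumm t δ := fun t =>
    summable_of_ne_finset_zero (s := {0}) fun j hj => by simp_all [δ]
  have hδ0 : δ ≠ 0 := by simp [δ]
  have hMpos : 0 < M := by
    refine bT.opNorm_pos (u := Nop q k c ζ (L0op q k c δ + L1op p a δ))
      (bN.hsumm_apply ((bL0.add bL1').hsumm_apply (hδ s))) ?_
    rw [hinv, hLinv₂ δ (hδ s)]
    exact hδ0
  have hνpos : 0 < ν := by
    refine bN.opNorm_pos (hδ _) fun h => ?_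
    have := congrFun h 0
    simp [Nop, δ, hne 0] at this
  have hlampos : 0 < lam := by
    obtain ⟨j, hj⟩ := hζ.exists_symb_ne_zero (by omega)
    refine bL0.opNorm_pos (u := Pi.single j 1)
      (summable_of_ne_finset_zero (s := {j}) fun i hi => by simp_all) fun h => hj ?_
    simpa [L0op] using congrFun h j
  refine ⟨1, 2 * M * ν * lam, one_pos, by positivity, le_rfl, fun N hN hsmall f hf => ?_⟩
  have coercive : ∀ v, hsumm s v → hnorm s v ≤
      2 * M * ν * hnorm (s - k) (L0op q k c v + projP N (L1op p a v)) := fun v hv => by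
    set R : (ℤ → ℂ) → (ℤ → ℂ) := fun u => u - projP N u
    have bR : IsSobolevBounded (s - p) (s - k) R := isSobolevBounded_sub_projP (by linarith) N
    have hg : hsumm (s - k) (L0op q k c v + projP N (L1op p a v)) :=
      (bL0.hsumm_apply hv).add
        ((isSobolevBounded_projP le_rfl N).hsumm_apply (bL1'.hsumm_apply hv))
    have hR := bR.hsumm_apply (bL1.hsumm_apply hv)
    have hsplit : L0op q k c v + L1op p a v =
        (L0op q k c v + projP N (L1op p a v)) + R (L1op p a v) := by simp only [R]; abel
    have h1 : hnorm s v ≤ M * hnorm s (Nop q k c ζ (L0op q k c v + L1op p a v)) := by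
      have := bT.hnorm_le (bN.hsumm_apply ((bL0.add bL1').hsumm_apply hv))
      rwa [hinv, hLinv₂ v hv] at this
    have h2 : hnorm s (Nop q k c ζ (L0op q k c v + L1op p a v)) ≤
        ν * (hnorm (s - k) (L0op q k c v + projP N (L1op p a v)) +
          D * (N : ℝ) ^ ((p : ℝ) - k) * (opNorm s (s - p) (L1op p a) * hnorm s v)) := by
      refine (bN.hnorm_le ((bL0.add bL1').hsumm_apply hv)).trans ?_
      refine mul_le_mul_of_nonneg_left ?_ hνpos.le
      rw [hsplit]
      refine (hnorm_add_le hg hR).trans ?_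
      gcongr
      refine (bR.hnorm_le (bL1.hsumm_apply hv)).trans ?_
      exact mul_le_mul (hD N hN) (bL1.hnorm_le hv) (hnorm_nonneg _ _)
        ((opNorm_nonneg _ _ _).trans (hD N hN))
    have h3 := mul_le_mul_of_nonneg_right (mul_le_mul_of_nonneg_left hsmall.le hMpos.le)
      (hnorm_nonneg s v)
    have h4 : M * (1 / 2 * M⁻¹) = 1 / 2 := by field_simp
    rw [h4] at h3
    have h5 := mul_le_mul_of_nonneg_left h2 hMpos.le
    linarith
  have hL0P : ∀ u, inPN N u → inPN N (L0op q k c u) := fun u hu => by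
    rw [inPN, projP_L0op, hu]
  refine ⟨existsUnique_of_inPN (fun u hu => ?_) (fun u v hu hv => ?_) (fun z u => ?_)
    (fun u hu h => ?_), fun uN huN heq => ⟨?_, ?_⟩⟩
  · rw [inPN, projP_add, hL0P u hu, projP_projP]
  · rw [L0op_add, L1op_add hl1 htl ha hu.hsumm hv.hsumm, projP_add, add_add_add_comm]
  · rw [L0op_smul, L1op_smul, projP_smul, smul_add]
  · have := coercive u hu.hsumm
    rw [h, hnorm_zero, mul_zero] at this
    exact eq_zero_of_hnorm_le_zero hu.hsumm this
  · have hu := (hLinv₁ f hf).1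
    rw [one_mul]
    simpa using (hnorm_le_of_norm_le zero_le_one (hu.sub huN.hsumm) (t := s)
      (v := Linv f - projP N (Linv f)) fun j => by
        rw [one_mul]
        exact mul_le_mul_of_nonneg_right (norm_sub_projP_le huN (Linv f) j)
          (wt_rpow_nonneg j s)).2
  · obtain ⟨hu, hLu⟩ := hLinv₁ f hf
    have hres : L0op q k c (Linv f - uN) + projP N (L1op p a (Linv f - uN)) =
        L0op q k c (Linv f - projP N (Linv f)) := by
      have hsub : ∀ x y : ℤ → ℂ, x - y = x + (-1 : ℂ) • y := fun x y => by simp [sub_eq_add_neg]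
      have h1 : projP N f = projP N (L0op q k c (Linv f)) + projP N (L1op p a (Linv f)) := by
        rw [← projP_add, hLu]
      rw [h1, projP_L0op] at heq
      rw [hsub, hsub, L0op_add, L0op_add, L0op_smul, L0op_smul,
        L1op_add hl1 htl ha hu (huN.hsumm.smul _), L1op_smul, projP_add, projP_smul,
        eq_sub_iff_add_eq.2 heq]
      module
    have h1 := coercive _ (hu.sub huN.hsumm)
    rw [hres] at h1
    have hPu := hu.sub ((isSobolevBounded_projP le_rfl N).hsumm_apply hu)
    have h2 := mul_le_mul_of_nonneg_left (bL0.hnorm_le hPu)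
      (by positivity : 0 ≤ 2 * M * ν)
    linarith

end
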